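/- Let h ≥ 1 be an integer and let (u_k), (v_k), (w_k), (z_k) be sequences in 𝔽_h such that for every k: u_k ∈ 𝔄_h(w_k); J_h(u_k, z_k) ≤ J_h(u, z_k) for every u ∈ 𝔄_h(w_k); and J_h(u_k, v_k) ≤ J_h(u_k, v) for every v ∈ 𝔽_h with v ≤ z_k on Ω. Assume that there exist ū, v̄, w̄, z̄ ∈ 𝔽_h with u_k → ū, v_k → v̄, w_k → w̄, z_k → z̄ in 𝔽_h as k → ∞. Then ū ∈ 𝔄_h(w̄); J_h(ū, z̄) ≤ J_h(u, z̄) for every u ∈ 𝔄_h(w̄); and J_h(ū, v̄) ≤ J_h(ū, v) for every v ∈ 𝔽_h with v ≤ z̄ on Ω. -/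

import Mathlib

open MeasureTheory Filter
open scoped Classical
open scoped RealInnerProductSpace

noncomputable section

abbrev E2 : Type := EuclideanSpace ℝ (Fin 2)

/-- The point `(a, b) ∈ ℝ²`. -/
def vtx (a b : ℝ) : E2 := (WithLp.equiv 2 (Fin 2 → ℝ)).symm ![a, b]

/-- The open unit square `Ω = (0,1)²`. -/
def Omega : Set E2 := {x | x 0 ∈ Set.Ioo (0:ℝ) 1 ∧ x 1 ∈ Set.Ioo (0:ℝ) 1}

/-- The closed unit square `Ω̄ = [0,1]²`. -/
def OmegaCl : Set E2 := {x | x 0 ∈ Set.Icc (0:ℝ) 1 ∧ x 1 ∈ Set.Icc (0:ℝ) 1}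

/-- The boundary `∂Ω = Ω̄ \ Ω`. -/
def OmegaBd : Set E2 := OmegaCl \ Omega

/-- Lower-left triangle `K⁺_{k,j}` of the uniform triangulation `𝒯_h`. -/
def Kplus (h k j : ℕ) : Set E2 :=
  {x | ((k:ℝ)-1)/h ≤ x 0 ∧ x 0 ≤ (k:ℝ)/h ∧ ((j:ℝ)-1)/h ≤ x 1 ∧
        x 1 ≤ ((j:ℝ)-1)/h + ((k:ℝ)/h - x 0)}

/-- Upper-right triangle `K⁻_{k,j}` of the uniform triangulation `𝒯_h`. -/
def Kminus (h k j : ℕ) : Set E2 :=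
  {x | ((k:ℝ)-1)/h ≤ x 0 ∧ x 0 ≤ (k:ℝ)/h ∧ (j:ℝ)/h + (((k:ℝ)-1)/h - x 0) ≤ x 1 ∧
        x 1 ≤ (j:ℝ)/h}

/-- `u` is affine on the set `S`. -/
def IsAffineOn (u : E2 → ℝ) (S : Set E2) : Prop :=
  ∃ (b : E2) (c : ℝ), ∀ x ∈ S, u x = ⟪b, x⟫ + c

/-- Membership in the finite element space `𝔽_h`: continuous on `Ω̄` and affine on every
triangle of the uniform triangulation `𝒯_h`. -/
def MemF (h : ℕ) (u : E2 → ℝ) : Prop :=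
  ContinuousOn u OmegaCl ∧
  ∀ k j : ℕ, 1 ≤ k → k ≤ h → 1 ≤ j → j ≤ h →
    IsAffineOn u (Kplus h k j) ∧ IsAffineOn u (Kminus h k j)

/-- The set `Δ_h` of vertices of the triangulation `𝒯_h`. -/
def Delta (h : ℕ) : Set E2 :=
  {x | ∃ k j : ℕ, k ≤ h ∧ j ≤ h ∧ x = vtx ((k:ℝ)/h) ((j:ℝ)/h)}

/-- The vertex `(k/h, j/h)` of `𝒯_h`. -/
def vertexPt (h k j : ℕ) : E2 := vtx ((k:ℝ)/h) ((j:ℝ)/h)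

/-- `p` is the Lagrange interpolant of `f` on `𝒯_h`: `p ∈ 𝔽_h` and `p = f` on `Δ_h`. -/
def Interpolates (h : ℕ) (f p : E2 → ℝ) : Prop :=
  MemF h p ∧ ∀ x ∈ Delta h, p x = f x

/-- The Lagrange interpolation operator `P_h` (a choice of interpolant; it is unique on `Ω̄`). -/

noncomputable def Ph (h : ℕ) (f : E2 → ℝ) : E2 → ℝ :=
  if hf : ∃ p, Interpolates h f p then hf.choose else 0

/-- Almost-everywhere defined gradient. -/
noncomputable def grad (u : E2 → ℝ) (x : E2) : E2 := gradient u x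

/-- The squared `H¹(Ω)` norm `‖u‖²_{H¹} = ∫_Ω (u² + |∇u|²)`. -/
noncomputable def H1normSq (u : E2 → ℝ) : ℝ :=
  ∫ x in Omega, ((u x)^2 + ‖grad u x‖^2)

/-- The discrete phase-field energy `J_h`. -/
noncomputable def Jh (h : ℕ) (η : ℝ) (u v : E2 → ℝ) : ℝ :=
  (1/2) * (∫ x in Omega, ((Ph h (fun y => (v y)^2) x + η) * ‖grad u x‖^2))
  + (1/2) * (∫ x in Omega, ‖grad v x‖^2)
  + (1/2) * (∫ x in Omega, Ph h (fun y => (1 - v y)^2) x)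

/-- `u ∈ 𝔄_h(w)`: `u ∈ 𝔽_h` and `u = w` on `∂Ω`. -/
def MemA (h : ℕ) (w u : E2 → ℝ) : Prop :=
  MemF h u ∧ ∀ x ∈ OmegaBd, u x = w x

/-- Convergence in `𝔽_h`, i.e. with respect to the `H¹(Ω)` norm. -/
def TendstoF (u : ℕ → E2 → ℝ) (ub : E2 → ℝ) : Prop :=
  Tendsto (fun j => H1normSq (fun y => u j y - ub y)) atTop (nhds 0)

/-- `u` minimizes `J_h(·, v)` over `𝔄_h(w)`. -/
def IsMinU (h : ℕ) (η : ℝ) (w v u : E2 → ℝ) : Prop :=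
  MemA h w u ∧ ∀ u', MemA h w u' → Jh h η u v ≤ Jh h η u' v

/-- `v` minimizes `J_h(u, ·)` over `{v ∈ 𝔽_h : v ≤ vprev on Ω}`. -/
def IsMinV (h : ℕ) (η : ℝ) (u vprev v : E2 → ℝ) : Prop :=
  (MemF h v ∧ ∀ x ∈ Omega, v x ≤ vprev x) ∧
  ∀ v', MemF h v' → (∀ x ∈ Omega, v' x ≤ vprev x) → Jh h η u v ≤ Jh h η u v'

end

lemma isOpen_Omega : IsOpen Omega := by
  have h0 : Continuous fun x : E2 => x 0 := by fun_prop
  have h1 : Continuous fun x : E2 => x 1 := by fun_prop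
  exact (isOpen_Ioo.preimage h0).inter (isOpen_Ioo.preimage h1)

lemma Omega_subset_OmegaCl : Omega ⊆ OmegaCl := fun _ hx =>
  ⟨Set.Ioo_subset_Icc_self hx.1, Set.Ioo_subset_Icc_self hx.2⟩

lemma OmegaCl_subset_closure_Omega : OmegaCl ⊆ closure Omega := by
  intro x hx
  obtain ⟨⟨h1, h2⟩, h3, h4⟩ := hx
  have hc : Continuous fun t : ℝ => x + t • (vtx (1 / 2) (1 / 2) - x) := by fun_prop
  have ht : Tendsto (fun t : ℝ => x + t • (vtx (1 / 2) (1 / 2) - x)) (nhdsWithin 0 (Set.Ioi 0))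
      (nhds x) := by
    have := hc.tendsto 0
    simp only [zero_smul, add_zero] at this
    exact this.mono_left nhdsWithin_le_nhds
  refine mem_closure_of_tendsto ht ?_
  filter_upwards [Ioo_mem_nhdsGT (zero_lt_one (α := ℝ))] with t htt
  obtain ⟨ht0, ht1⟩ := htt
  refine ⟨⟨?_, ?_⟩, ?_, ?_⟩ <;> simp [vtx] <;> nlinarith

lemma isFiniteMeasure_restrict_Omega : IsFiniteMeasure (volume.restrict Omega) := by
  have hb : Bornology.IsBounded Omega := by
    refine (Metric.isBounded_closedBall (x := (0 : E2)) (r := 2)).subset fun x hx => ?_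
    obtain ⟨⟨h1, h2⟩, h3, h4⟩ := hx
    rw [mem_closedBall_zero_iff, EuclideanSpace.norm_eq, Fin.sum_univ_two]
    refine Real.sqrt_le_iff.2 ⟨by norm_num, ?_⟩
    simp only [Real.norm_eq_abs, sq_abs]
    nlinarith
  exact ⟨by rw [Measure.restrict_apply_univ]; exact hb.measure_lt_top⟩

lemma inner_vtx (p q : ℝ) (x : E2) : ⟪vtx p q, x⟫ = p * x 0 + q * x 1 := by
  simp [PiLp.inner_apply, Fin.sum_univ_two, vtx, mul_comm]

lemma IsAffineOn.add {u v : E2 → ℝ} {S : Set E2} (hu : IsAffineOn u S) (hv : IsAffineOn v S) :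
    IsAffineOn (fun x => u x + v x) S := by
  obtain ⟨b, c, h⟩ := hu
  obtain ⟨b', c', h'⟩ := hv
  exact ⟨b + b', c + c', fun x hx => by simp only [h x hx, h' x hx, inner_add_left]; ring⟩

lemma IsAffineOn.const_mul {u : E2 → ℝ} {S : Set E2} (a : ℝ) (hu : IsAffineOn u S) :
    IsAffineOn (fun x => a * u x) S := by
  obtain ⟨b, c, h⟩ := hu
  exact ⟨a • b, a * c, fun x hx => by simp only [h x hx, real_inner_smul_left]; ring⟩

lemma MemF.add {h : ℕ} {u v : E2 → ℝ} (hu : MemF h u) (hv : MemF h v) :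
    MemF h (fun x => u x + v x) :=
  ⟨hu.1.add hv.1, fun k j h1 h2 h3 h4 =>
    ⟨(hu.2 k j h1 h2 h3 h4).1.add (hv.2 k j h1 h2 h3 h4).1,
      (hu.2 k j h1 h2 h3 h4).2.add (hv.2 k j h1 h2 h3 h4).2⟩⟩

lemma MemF.const_mul {h : ℕ} {u : E2 → ℝ} (a : ℝ) (hu : MemF h u) :
    MemF h (fun x => a * u x) :=
  ⟨continuousOn_const.mul hu.1, fun k j h1 h2 h3 h4 =>
    ⟨(hu.2 k j h1 h2 h3 h4).1.const_mul a, (hu.2 k j h1 h2 h3 h4).2.const_mul a⟩⟩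

lemma MemF.sub {h : ℕ} {u v : E2 → ℝ} (hu : MemF h u) (hv : MemF h v) :
    MemF h (fun x => u x - v x) := by
  have := hu.add (hv.const_mul (-1))
  simpa [sub_eq_add_neg] using this

lemma MemF.sum {h : ℕ} {ι : Type*} (s : Finset ι) (f : ι → E2 → ℝ) (hf : ∀ i, MemF h (f i)) :
    MemF h (fun x => ∑ i ∈ s, f i x) := by
  induction s using Finset.induction_on with
  | empty =>
    exact ⟨by simpa using continuousOn_const, fun _ _ _ _ _ _ =>
      ⟨⟨0, 0, by simp⟩, ⟨0, 0, by simp⟩⟩⟩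
  | insert a s ha ih =>
    simp only [Finset.sum_insert ha]
    exact (hf a).add ih

/-- The vertex of `𝒯_h` with index `i`. -/
noncomputable def node (h : ℕ) (i : Fin (h + 1) × Fin (h + 1)) : E2 := vertexPt h i.1 i.2

/-- The hat function of the uniform triangulation in the reference coordinates. -/
noncomputable def refHat (s t : ℝ) : ℝ := max 0 (1 - max |s| (max |t| |s + t|))

/-- The nodal basis function at the vertex with index `i`. -/
noncomputable def hat (h : ℕ) (i : Fin (h + 1) × Fin (h + 1)) (x : E2) : ℝ :=
  refHat (h * x 0 - (i.1 : ℕ)) (h * x 1 - (i.2 : ℕ))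

/-- The finite element function with nodal values `c`. -/
noncomputable def interp (h : ℕ) (c : Fin (h + 1) × Fin (h + 1) → ℝ) (x : E2) : ℝ :=
  ∑ i, c i * hat h i x

lemma max_abs_affine (a b d : ℤ) : ∃ (p q : ℝ) (N : ℤ), ∀ s t : ℝ, a ≤ s → s ≤ a + 1 → b ≤ t →
    t ≤ b + 1 → d ≤ s + t → s + t ≤ d + 1 →
    max |s| (max |t| |s + t|) = p * s + q * t ∧ N ≤ p * s + q * t ∧ p * s + q * t ≤ N + 1 := by
  have sgn : ∀ n : ℤ, (0 : ℝ) ≤ n ∨ (n : ℝ) + 1 ≤ 0 := fun n => by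
    rcases le_or_gt 0 n with hn | hn
    · exact Or.inl (by exact_mod_cast hn)
    · exact Or.inr (by exact_mod_cast hn)
  have key : ∀ s t m : ℝ, |s| ≤ m → |t| ≤ m → |s + t| ≤ m →
      (m ≤ |s| ∨ m ≤ |t| ∨ m ≤ |s + t|) → max |s| (max |t| |s + t|) = m := by
    intro s t m h1 h2 h3 h4
    refine le_antisymm (max_le h1 (max_le h2 h3)) ?_
    simpa [le_max_iff] using h4
  rcases sgn a with ha | ha <;> rcases sgn b with hb | hb
  · refine ⟨1, 1, d, fun s t h1 h2 h3 h4 h5 h6 => ⟨key _ _ _ ?_ ?_ ?_ ?_, by linarith, by linarith⟩⟩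
    iterate 3 exact abs_le.2 ⟨by linarith, by linarith⟩
    exact Or.inr (Or.inr (by rw [one_mul, one_mul]; exact le_abs_self _))
  · rcases sgn d with hd | hd
    · refine ⟨1, 0, a, fun s t h1 h2 h3 h4 h5 h6 =>
        ⟨key _ _ _ ?_ ?_ ?_ ?_, by linarith, by linarith⟩⟩
      iterate 3 exact abs_le.2 ⟨by linarith, by linarith⟩
      exact Or.inl (by linarith [le_abs_self s])
    · refine ⟨0, -1, -b - 1, fun s t h1 h2 h3 h4 h5 h6 =>
        ⟨key _ _ _ ?_ ?_ ?_ ?_, by push_cast; linarith, by push_cast; linarith⟩⟩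
      iterate 3 exact abs_le.2 ⟨by linarith, by linarith⟩
      exact Or.inr (Or.inl (by linarith [neg_le_abs t]))
  · rcases sgn d with hd | hd
    · refine ⟨0, 1, b, fun s t h1 h2 h3 h4 h5 h6 =>
        ⟨key _ _ _ ?_ ?_ ?_ ?_, by linarith, by linarith⟩⟩
      iterate 3 exact abs_le.2 ⟨by linarith, by linarith⟩
      exact Or.inr (Or.inl (by linarith [le_abs_self t]))
    · refine ⟨-1, 0, -a - 1, fun s t h1 h2 h3 h4 h5 h6 =>
        ⟨key _ _ _ ?_ ?_ ?_ ?_, by push_cast; linarith, by push_cast; linarith⟩⟩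
      iterate 3 exact abs_le.2 ⟨by linarith, by linarith⟩
      exact Or.inl (by linarith [neg_le_abs s])
  · refine ⟨-1, -1, -d - 1, fun s t h1 h2 h3 h4 h5 h6 =>
      ⟨key _ _ _ ?_ ?_ ?_ ?_, by push_cast; linarith, by push_cast; linarith⟩⟩
    iterate 3 exact abs_le.2 ⟨by linarith, by linarith⟩
    exact Or.inr (Or.inr (by linarith [neg_le_abs (s + t)]))

lemma refHat_affine (a b d : ℤ) : ∃ p q r : ℝ, ∀ s t : ℝ, a ≤ s → s ≤ a + 1 → b ≤ t →
    t ≤ b + 1 → d ≤ s + t → s + t ≤ d + 1 → refHat s t = p * s + q * t + r := by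
  obtain ⟨p, q, N, H⟩ := max_abs_affine a b d
  rcases le_or_gt N 0 with hN | hN
  · refine ⟨-p, -q, 1, fun s t h1 h2 h3 h4 h5 h6 => ?_⟩
    obtain ⟨e, e1, e2⟩ := H s t h1 h2 h3 h4 h5 h6
    have : (N : ℝ) ≤ 0 := by exact_mod_cast hN
    rw [refHat, e, max_eq_right (by linarith)]
    ring
  · refine ⟨0, 0, 0, fun s t h1 h2 h3 h4 h5 h6 => ?_⟩
    obtain ⟨e, e1, e2⟩ := H s t h1 h2 h3 h4 h5 h6
    have : (1 : ℝ) ≤ N := by exact_mod_cast hN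
    rw [refHat, e, max_eq_left (by linarith)]
    ring

lemma hat_isAffineOn (h : ℕ) (i : Fin (h + 1) × Fin (h + 1)) (a b d : ℤ) (S : Set E2)
    (hS : ∀ x ∈ S, (a : ℝ) ≤ h * x 0 ∧ h * x 0 ≤ a + 1 ∧ b ≤ h * x 1 ∧ h * x 1 ≤ b + 1 ∧
      d ≤ h * x 0 + h * x 1 ∧ h * x 0 + h * x 1 ≤ d + 1) : IsAffineOn (hat h i) S := by
  obtain ⟨p, q, r, H⟩ := refHat_affine (a - (i.1 : ℕ)) (b - (i.2 : ℕ)) (d - (i.1 : ℕ) - (i.2 : ℕ))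
  refine ⟨vtx (p * h) (q * h), r - p * (i.1 : ℕ) - q * (i.2 : ℕ), fun x hx => ?_⟩
  obtain ⟨h1, h2, h3, h4, h5, h6⟩ := hS x hx
  rw [hat, H, inner_vtx]
  · ring
  all_goals push_cast; linarith

lemma hat_continuous (h : ℕ) (i : Fin (h + 1) × Fin (h + 1)) : Continuous (hat h i) := by
  unfold hat refHat
  fun_prop

lemma hat_memF {h : ℕ} (hh : 1 ≤ h) (i : Fin (h + 1) × Fin (h + 1)) : MemF h (hat h i) := by
  have hpos : (0 : ℝ) < h := by exact_mod_cast hh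
  refine ⟨(hat_continuous h i).continuousOn, fun k j _ _ _ _ => ⟨?_, ?_⟩⟩
  · refine hat_isAffineOn h i (k - 1) (j - 1) (k + j - 2) _ fun x hx => ?_
    obtain ⟨h1, h2, h3, h4⟩ := hx
    rw [← sub_le_iff_le_add', ← sub_nonneg] at h4
    have h4' := mul_nonneg hpos.le h4
    rw [div_le_iff₀ hpos] at h1 h3
    rw [le_div_iff₀ hpos] at h2
    field_simp at h4'
    push_cast
    refine ⟨?_, ?_, ?_, ?_, ?_, ?_⟩ <;> linarith
  · refine hat_isAffineOn h i (k - 1) (j - 1) (k + j - 1) _ fun x hx => ?_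
    obtain ⟨h1, h2, h3, h4⟩ := hx
    rw [← sub_nonneg] at h3
    have h3' := mul_nonneg hpos.le h3
    rw [div_le_iff₀ hpos] at h1
    rw [le_div_iff₀ hpos] at h2 h4
    field_simp at h3'
    push_cast
    refine ⟨?_, ?_, ?_, ?_, ?_, ?_⟩ <;> linarith

lemma refHat_intCast (m n : ℤ) : refHat m n = if m = 0 ∧ n = 0 then 1 else 0 := by
  split_ifs with hmn
  · simp [refHat, hmn.1, hmn.2]
  · have : 1 ≤ max |m| |n| := by
      by_contra! hlt
      rw [max_lt_iff, Int.abs_lt_one_iff, Int.abs_lt_one_iff] at hlt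
      exact hmn hlt
    have h2 : (1 : ℝ) ≤ max |(m : ℝ)| |(n : ℝ)| := by exact_mod_cast this
    refine max_eq_left ?_
    have : max |(m : ℝ)| |(n : ℝ)| ≤ max |(m : ℝ)| (max |(n : ℝ)| |(m : ℝ) + n|) :=
      max_le_max le_rfl (le_max_left _ _)
    linarith

lemma hat_node {h : ℕ} (hh : 1 ≤ h) (i j : Fin (h + 1) × Fin (h + 1)) :
    hat h i (node h j) = if i = j then 1 else 0 := by
  have hpos : (h : ℝ) ≠ 0 := by positivity
  have e : hat h i (node h j)
      = refHat (((j.1 : ℕ) - (i.1 : ℕ) : ℤ) : ℝ) (((j.2 : ℕ) - (i.2 : ℕ) : ℤ) : ℝ) := by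
    simp [hat, node, vertexPt, vtx, mul_div_cancel₀ _ hpos]
  rw [e, refHat_intCast]
  congr 1
  simp only [Prod.ext_iff, Fin.ext_iff, eq_iff_iff]
  omega

lemma interp_node {h : ℕ} (hh : 1 ≤ h) (c : Fin (h + 1) × Fin (h + 1) → ℝ)
    (j : Fin (h + 1) × Fin (h + 1)) : interp h c (node h j) = c j := by
  simp [interp, hat_node hh]

lemma interp_continuous (h : ℕ) (c : Fin (h + 1) × Fin (h + 1) → ℝ) : Continuous (interp h c) :=
  continuous_finsetSum _ fun i _ => continuous_const.mul (hat_continuous h i)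

lemma interp_memF {h : ℕ} (hh : 1 ≤ h) (c : Fin (h + 1) × Fin (h + 1) → ℝ) :
    MemF h (interp h c) :=
  MemF.sum _ _ fun i => (hat_memF hh i).const_mul (c i)

lemma exists_cell {h : ℕ} (hh : 1 ≤ h) {y : ℝ} (hy : y ∈ Set.Icc (0 : ℝ) 1) :
    ∃ k : ℕ, k + 1 ≤ h ∧ (k : ℝ) ≤ h * y ∧ h * y ≤ k + 1 := by
  have hpos : (0 : ℝ) < h := by exact_mod_cast hh
  have hy0 : 0 ≤ h * y := mul_nonneg hpos.le hy.1
  rcases hy.2.eq_or_lt with rfl | hlt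
  · refine ⟨h - 1, by omega, ?_⟩
    push_cast [hh]
    constructor <;> linarith
  · refine ⟨⌊h * y⌋₊, ?_, Nat.floor_le hy0, (Nat.lt_floor_add_one _).le⟩
    rw [Nat.succ_le_iff, Nat.floor_lt hy0]
    nlinarith

/-- A point of the closed square lies in a triangle of the triangulation. -/
lemma exists_triangle {h : ℕ} (hh : 1 ≤ h) {x : E2} (hx : x ∈ OmegaCl) :
    ∃ k j : ℕ, k + 1 ≤ h ∧ j + 1 ≤ h ∧ (x ∈ Kplus h (k + 1) (j + 1) ∨
      x ∈ Kminus h (k + 1) (j + 1)) := by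
  have hpos : (0 : ℝ) < h := by exact_mod_cast hh
  obtain ⟨k, hk, hk1, hk2⟩ := exists_cell hh hx.1
  obtain ⟨j, hj, hj1, hj2⟩ := exists_cell hh hx.2
  refine ⟨k, j, hk, hj, ?_⟩
  have e1 : (((k + 1 : ℕ) : ℝ) - 1) / h ≤ x 0 := by
    rw [div_le_iff₀ hpos]; push_cast; linarith
  have e2 : x 0 ≤ ((k + 1 : ℕ) : ℝ) / h := by
    rw [le_div_iff₀ hpos]; push_cast; linarith
  have e3 : (((j + 1 : ℕ) : ℝ) - 1) / h ≤ x 1 := by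
    rw [div_le_iff₀ hpos]; push_cast; linarith
  have e4 : x 1 ≤ ((j + 1 : ℕ) : ℝ) / h := by
    rw [le_div_iff₀ hpos]; push_cast; linarith
  rcases le_total (x 1) ((((j + 1 : ℕ) : ℝ) - 1) / h + (((k + 1 : ℕ) : ℝ) / h - x 0)) with hc | hc
  · exact Or.inl ⟨e1, e2, e3, hc⟩
  · refine Or.inr ⟨e1, e2, ?_, e4⟩
    have : ((j + 1 : ℕ) : ℝ) / h + ((((k + 1 : ℕ) : ℝ) - 1) / h - x 0)
        = (((j + 1 : ℕ) : ℝ) - 1) / h + (((k + 1 : ℕ) : ℝ) / h - x 0) := by ring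
    rwa [this]

lemma IsAffineOn.eq_zero_of_vertices {u : E2 → ℝ} {S : Set E2} (hu : IsAffineOn u S)
    {a b δ : ℝ} (hδ : δ ≠ 0) (h1 : vtx a b ∈ S) (h2 : vtx (a + δ) b ∈ S) (h3 : vtx a (b + δ) ∈ S)
    (u1 : u (vtx a b) = 0) (u2 : u (vtx (a + δ) b) = 0) (u3 : u (vtx a (b + δ)) = 0) :
    ∀ x ∈ S, u x = 0 := by
  obtain ⟨v, c, H⟩ := hu
  have hin : ∀ p q : ℝ, ⟪v, vtx p q⟫ = v 0 * p + v 1 * q := fun p q => by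
    rw [real_inner_comm, inner_vtx]; ring
  rw [H _ h1, hin] at u1
  rw [H _ h2, hin] at u2
  rw [H _ h3, hin] at u3
  have v0 : v 0 = 0 := by
    have : v 0 * δ = 0 := by linarith
    simpa [hδ] using this
  have v1 : v 1 = 0 := by
    have : v 1 * δ = 0 := by linarith
    simpa [hδ] using this
  intro x hx
  rw [H x hx, PiLp.inner_apply, Fin.sum_univ_two, v0, v1]
  rw [v0, v1] at u1
  simpa using u1

lemma MemF.eq_zero_of_nodes {h : ℕ} (hh : 1 ≤ h) {u : E2 → ℝ} (hu : MemF h u)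
    (h0 : ∀ i, u (node h i) = 0) : ∀ x ∈ OmegaCl, u x = 0 := by
  have hpos : (0 : ℝ) < h := by exact_mod_cast hh
  have hz : ∀ m n : ℕ, m ≤ h → n ≤ h → u (vtx ((m : ℝ) / h) ((n : ℝ) / h)) = 0 := fun m n hm hn =>
    h0 (⟨m, Nat.lt_succ_of_le hm⟩, ⟨n, Nat.lt_succ_of_le hn⟩)
  intro x hx
  obtain ⟨k, j, hk, hj, hT⟩ := exists_triangle hh hx
  have hA := hu.2 (k + 1) (j + 1) (by omega) hk (by omega) hj
  have ad : ∀ n : ℕ, (n : ℝ) / h + 1 / h = ((n + 1 : ℕ) : ℝ) / h := fun n => by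
    push_cast; ring
  have su : ∀ n : ℕ, ((n + 1 : ℕ) : ℝ) / h + -(1 / h) = (n : ℝ) / h := fun n => by
    push_cast; ring
  have hdiv : (0 : ℝ) < 1 / h := by positivity
  have mono : ∀ n : ℕ, (n : ℝ) / h ≤ ((n + 1 : ℕ) : ℝ) / h := fun n => by rw [← ad]; linarith
  rcases hT with hT | hT
  · refine hA.1.eq_zero_of_vertices (a := (k : ℝ) / h) (b := (j : ℝ) / h) (δ := 1 / h) hdiv.ne'
      ?_ ?_ ?_ ?_ ?_ ?_ x hT
    iterate 3
      simp only [Kplus, Set.mem_ofPred_eq, vtx, WithLp.equiv_symm_apply, Matrix.cons_val_zero,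
        Matrix.cons_val_one]
      have e1 := ad k
      have e2 := ad j
      push_cast at e1 e2 ⊢
      simp only [add_sub_cancel_right]
      refine ⟨?_, ?_, ?_, ?_⟩ <;> linarith
    · exact hz _ _ (by omega) (by omega)
    · rw [ad]; exact hz _ _ (by omega) (by omega)
    · rw [ad]; exact hz _ _ (by omega) (by omega)
  · refine hA.2.eq_zero_of_vertices (a := ((k + 1 : ℕ) : ℝ) / h) (b := ((j + 1 : ℕ) : ℝ) / h)
      (δ := -(1 / h)) (by linarith) ?_ ?_ ?_ ?_ ?_ ?_ x hT
    iterate 3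
      simp only [Kminus, Set.mem_ofPred_eq, vtx, WithLp.equiv_symm_apply, Matrix.cons_val_zero,
        Matrix.cons_val_one]
      have e1 := ad k
      have e2 := ad j
      push_cast at e1 e2 ⊢
      simp only [add_sub_cancel_right]
      refine ⟨?_, ?_, ?_, ?_⟩ <;> linarith
    · exact hz _ _ (by omega) (by omega)
    · rw [su]; exact hz _ _ (by omega) (by omega)
    · rw [su]; exact hz _ _ (by omega) (by omega)

lemma MemF.eq_interp {h : ℕ} (hh : 1 ≤ h) {u : E2 → ℝ} (hu : MemF h u) :
    ∀ x ∈ OmegaCl, u x = interp h (fun i => u (node h i)) x := by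
  intro x hx
  refine sub_eq_zero.1 ((hu.sub (interp_memF hh fun i => u (node h i))).eq_zero_of_nodes hh ?_ x hx)
  intro i
  rw [interp_node hh, sub_self]

lemma Ph_eq_interp {h : ℕ} (hh : 1 ≤ h) (f : E2 → ℝ) :
    ∀ x ∈ OmegaCl, Ph h f x = interp h (fun i => f (node h i)) x := by
  have hex : ∃ p, Interpolates h f p := by
    refine ⟨interp h fun i => f (node h i), interp_memF hh _, ?_⟩
    rintro _ ⟨k, j, hk, hj, rfl⟩
    exact interp_node hh _ (⟨k, Nat.lt_succ_of_le hk⟩, ⟨j, Nat.lt_succ_of_le hj⟩)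
  have hP : Ph h f = hex.choose := dif_pos hex
  obtain ⟨h1, h2⟩ := hex.choose_spec
  rw [← hP] at h1 h2
  intro x hx
  rw [h1.eq_interp hh x hx]
  congr 1
  ext i
  exact h2 _ ⟨i.1, i.2, Nat.le_of_lt_succ i.1.2, Nat.le_of_lt_succ i.2.2, rfl⟩

lemma node_mem_OmegaCl {h : ℕ} (hh : 1 ≤ h) (i : Fin (h + 1) × Fin (h + 1)) :
    node h i ∈ OmegaCl := by
  have hpos : (0 : ℝ) < h := by exact_mod_cast hh
  have key : ∀ m : Fin (h + 1), ((m : ℕ) : ℝ) / h ∈ Set.Icc (0 : ℝ) 1 := fun m =>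
    ⟨by positivity, by
      rw [div_le_one hpos]
      exact_mod_cast Nat.le_of_lt_succ m.2⟩
  exact ⟨key i.1, key i.2⟩

lemma hat_lipschitz (h : ℕ) (i : Fin (h + 1) × Fin (h + 1)) : ∃ K, LipschitzWith K (hat h i) := by
  have coord : ∀ (l : Fin 2) (c : ℝ), ∃ K, LipschitzWith K fun x : E2 => (h : ℝ) * x l - c :=
    fun l c => ⟨_, ((h : ℝ) • (EuclideanSpace.proj l : E2 →L[ℝ] ℝ)).lipschitz.sub
      (LipschitzWith.const c)⟩
  have habs : ∀ f : E2 → ℝ, (∃ K, LipschitzWith K f) → ∃ K, LipschitzWith K fun x => |f x| :=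
    fun f ⟨K, hf⟩ => ⟨_, lipschitzWith_one_norm.comp hf⟩
  obtain ⟨K0, h0⟩ := coord 0 (i.1 : ℕ)
  obtain ⟨K1, h1⟩ := coord 1 (i.2 : ℕ)
  obtain ⟨L0, a0⟩ := habs _ ⟨_, h0⟩
  obtain ⟨L1, a1⟩ := habs _ ⟨_, h1⟩
  obtain ⟨L2, a2⟩ := habs _ ⟨_, h0.add h1⟩
  exact ⟨_, ((LipschitzWith.const (1 : ℝ)).sub (a0.max (a1.max a2))).const_max 0⟩

/-- Values and gradients of the nodal basis functions at a point. -/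
noncomputable def basisJet (h : ℕ) (x : E2) : Fin (h + 1) × Fin (h + 1) → ℝ × E2 :=
  fun i => (hat h i x, gradient (hat h i) x)

lemma norm_gradient_eq (f : E2 → ℝ) (x : E2) : ‖gradient f x‖ = ‖fderiv ℝ f x‖ := by
  rw [gradient, LinearIsometryEquiv.norm_map]

lemma measurable_basisJet (h : ℕ) : Measurable (basisJet h) := by
  refine measurable_pi_lambda _ fun i => (hat_continuous h i).measurable.prodMk ?_
  exact (InnerProductSpace.toDual ℝ E2).symm.continuous.measurable.comp (measurable_fderiv ℝ _)

lemma abs_refHat_le (s t : ℝ) : |refHat s t| ≤ 1 := by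
  rw [refHat, abs_of_nonneg (le_max_left _ _)]
  refine max_le zero_le_one ?_
  linarith [(abs_nonneg s).trans (le_max_left |s| (max |t| |s + t|))]

lemma bounded_basisJet (h : ℕ) : ∃ R, ∀ x, ‖basisJet h x‖ ≤ R := by
  choose K hK using hat_lipschitz h
  refine ⟨1 + ∑ i, (K i : ℝ), fun x => ?_⟩
  have hs : 0 ≤ ∑ i, (K i : ℝ) := Finset.sum_nonneg fun i _ => (K i).2
  refine (pi_norm_le_iff_of_nonneg (by linarith)).2 fun i => ?_
  refine (Prod.norm_def _).le.trans (max_le ?_ ?_)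
  · exact (abs_refHat_le _ _).trans (by linarith)
  · change ‖gradient (hat h i) x‖ ≤ _
    rw [norm_gradient_eq]
    have h1 := norm_fderiv_le_of_lipschitz ℝ (hK i) (x₀ := x)
    have h2 : (K i : ℝ) ≤ ∑ i, (K i : ℝ) :=
      Finset.single_le_sum (f := fun i => (K i : ℝ)) (fun i _ => (K i).2) (Finset.mem_univ i)
    linarith

lemma ae_grad_eq {h : ℕ} (hh : 1 ≤ h) : ∀ᵐ x ∂(volume.restrict Omega), ∀ u, MemF h u →
    grad u x = ∑ i, u (node h i) • (basisJet h x i).2 := by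
  have hd : ∀ᵐ x ∂(volume.restrict Omega), ∀ i, DifferentiableAt ℝ (hat h i) x := by
    rw [ae_all_iff]
    intro i
    obtain ⟨K, hK⟩ := hat_lipschitz h i
    exact ae_restrict_of_ae hK.ae_differentiableAt
  filter_upwards [hd, ae_restrict_mem isOpen_Omega.measurableSet] with x hx hxO u hu
  have he : u =ᶠ[nhds x] interp h (fun i => u (node h i)) := by
    filter_upwards [isOpen_Omega.mem_nhds hxO] with y hy
    exact hu.eq_interp hh y (Omega_subset_OmegaCl hy)
  have hf : HasFDerivAt (interp h fun i => u (node h i))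
      (∑ i, u (node h i) • fderiv ℝ (hat h i) x) x :=
    HasFDerivAt.fun_sum fun i _ => (hx i).hasFDerivAt.const_mul _
  rw [grad, gradient, he.fderiv_eq, hf.fderiv]
  simp [basisJet, gradient]

section ParametricIntegrals

variable {P Q : Type*} [MetricSpace P] [NormedAddCommGroup Q] [ProperSpace Q]
  [MeasurableSpace Q] [BorelSpace Q]

lemma integrable_continuous_comp {F : Q → ℝ} (hF : Continuous F) {q : E2 → Q} (hq : Measurable q)
    {R : ℝ} (hR : ∀ x, ‖q x‖ ≤ R) : Integrable (fun x => F (q x)) (volume.restrict Omega) := by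
  have := isFiniteMeasure_restrict_Omega
  obtain ⟨C, hC⟩ := (isCompact_closedBall (0 : Q) R).exists_bound_of_continuousOn hF.continuousOn
  exact Integrable.of_bound (hF.measurable.comp hq).aestronglyMeasurable C
    (Eventually.of_forall fun x => hC _ (mem_closedBall_zero_iff.2 (hR x)))

lemma tendsto_integral_continuous_comp {F : P × Q → ℝ} (hF : Continuous F) {q : E2 → Q}
    (hq : Measurable q) {R : ℝ} (hR : ∀ x, ‖q x‖ ≤ R) {p : ℕ → P} {p₀ : P}
    (hp : Tendsto p atTop (nhds p₀)) :
    Tendsto (fun n => ∫ x in Omega, F (p n, q x)) atTop (nhds (∫ x in Omega, F (p₀, q x))) := by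
  have := isFiniteMeasure_restrict_Omega
  obtain ⟨C, hC⟩ := (hp.isCompact_insert_range.prod
    (isCompact_closedBall (0 : Q) R)).exists_bound_of_continuousOn hF.continuousOn
  refine tendsto_integral_of_dominated_convergence (fun _ => C) (fun n => ?_) (integrable_const C)
    (fun n => Eventually.of_forall fun x => hC _
      ⟨Or.inr ⟨n, rfl⟩, mem_closedBall_zero_iff.2 (hR x)⟩) (Eventually.of_forall fun x => ?_)
  · exact ((hF.comp (by fun_prop : Continuous fun y : Q => (p n, y))).measurable.comp
      hq).aestronglyMeasurable
  · exact (hF.tendsto _).comp (hp.prodMk_nhds tendsto_const_nhds)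

end ParametricIntegrals

lemma MemF.tendsto_Jh {h : ℕ} (hh : 1 ≤ h) (η : ℝ) {u v : ℕ → E2 → ℝ} {ub vb : E2 → ℝ}
    (hu : ∀ n, MemF h (u n)) (hv : ∀ n, MemF h (v n)) (hub : MemF h ub) (hvb : MemF h vb)
    (tu : ∀ i, Tendsto (fun n => u n (node h i)) atTop (nhds (ub (node h i))))
    (tv : ∀ i, Tendsto (fun n => v n (node h i)) atTop (nhds (vb (node h i)))) :
    Tendsto (fun n => Jh h η (u n) (v n)) atTop (nhds (Jh h η ub vb)) := by
  obtain ⟨R, hR⟩ := bounded_basisJet h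
  have hm := measurable_basisJet h
  let V := Fin (h + 1) × Fin (h + 1) → ℝ
  let F₁ : (V × V) × (Fin (h + 1) × Fin (h + 1) → ℝ × E2) → ℝ := fun z =>
    (∑ i, (z.1.2 i) ^ 2 * (z.2 i).1 + η) * ‖∑ i, z.1.1 i • (z.2 i).2‖ ^ 2
  let F₂ : (V × V) × (Fin (h + 1) × Fin (h + 1) → ℝ × E2) → ℝ := fun z =>
    ‖∑ i, z.1.2 i • (z.2 i).2‖ ^ 2
  let F₃ : (V × V) × (Fin (h + 1) × Fin (h + 1) → ℝ × E2) → ℝ := fun z =>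
    ∑ i, (1 - z.1.2 i) ^ 2 * (z.2 i).1
  have c₁ : Continuous F₁ := by fun_prop
  have c₂ : Continuous F₂ := by fun_prop
  have c₃ : Continuous F₃ := by fun_prop
  have hJ : ∀ u v : E2 → ℝ, MemF h u → MemF h v → Jh h η u v =
      (1/2) * (∫ x in Omega, F₁ ((fun i => u (node h i), fun i => v (node h i)), basisJet h x))
      + (1/2) * (∫ x in Omega, F₂ ((fun i => u (node h i), fun i => v (node h i)), basisJet h x))
      + (1/2) *
        (∫ x in Omega, F₃ ((fun i => u (node h i), fun i => v (node h i)), basisJet h x)) := by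
    intro u v hu hv
    unfold Jh
    congr 1
    · congr 2
      · refine integral_congr_ae ?_
        filter_upwards [ae_grad_eq hh, ae_restrict_mem isOpen_Omega.measurableSet] with x hx hxO
        rw [hx u hu, Ph_eq_interp hh _ x (Omega_subset_OmegaCl hxO)]
        rfl
      · refine integral_congr_ae ?_
        filter_upwards [ae_grad_eq hh] with x hx
        rw [hx v hv]
    · congr 1
      refine setIntegral_congr_fun isOpen_Omega.measurableSet fun x hxO => ?_
      exact Ph_eq_interp hh _ x (Omega_subset_OmegaCl hxO)
  have hp : Tendsto (fun n => ((fun i => u n (node h i), fun i => v n (node h i)) : V × V)) atTop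
      (nhds (fun i => ub (node h i), fun i => vb (node h i))) :=
    (tendsto_pi_nhds.2 tu).prodMk_nhds (tendsto_pi_nhds.2 tv)
  rw [hJ ub vb hub hvb]
  simp only [fun n => hJ (u n) (v n) (hu n) (hv n)]
  exact (((tendsto_integral_continuous_comp c₁ hm hR hp).const_mul _).add
    ((tendsto_integral_continuous_comp c₂ hm hR hp).const_mul _)).add
    ((tendsto_integral_continuous_comp c₃ hm hR hp).const_mul _)

lemma interp_eq_zero_of_integral_sq {h : ℕ} (hh : 1 ≤ h) {c : Fin (h + 1) × Fin (h + 1) → ℝ}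
    (hint : Integrable (fun x => interp h c x ^ 2) (volume.restrict Omega))
    (hc : ∫ x in Omega, interp h c x ^ 2 = 0) : c = 0 := by
  rw [integral_eq_zero_iff_of_nonneg (fun x => sq_nonneg _) hint] at hc
  have h0 : Set.EqOn (fun x => interp h c x ^ 2) 0 Omega :=
    Measure.eqOn_open_of_ae_eq hc isOpen_Omega ((interp_continuous h c).pow 2).continuousOn
      continuousOn_const
  have h1 := h0.closure ((interp_continuous h c).pow 2) continuous_const
  ext i
  have h2 := h1 (OmegaCl_subset_closure_Omega (node_mem_OmegaCl hh i))
  simpa [interp_node hh] using h2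

/-- The `H¹` norm controls the nodal values. -/
lemma exists_coercive {h : ℕ} (hh : 1 ≤ h) : ∃ m : ℝ, 0 < m ∧ ∀ u, MemF h u →
    m * ‖fun i => u (node h i)‖ ^ 2 ≤ H1normSq u := by
  obtain ⟨R, hR⟩ := bounded_basisJet h
  have hm := measurable_basisJet h
  let V := Fin (h + 1) × Fin (h + 1) → ℝ
  let F : V × (Fin (h + 1) × Fin (h + 1) → ℝ × E2) → ℝ := fun z => (∑ i, z.1 i * (z.2 i).1) ^ 2
  let G : V × (Fin (h + 1) × Fin (h + 1) → ℝ × E2) → ℝ := fun z => ‖∑ i, z.1 i • (z.2 i).2‖ ^ 2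
  have cF : Continuous F := by fun_prop
  have cG : Continuous G := by fun_prop
  have iF : ∀ c, Integrable (fun x => F (c, basisJet h x)) (volume.restrict Omega) := fun c =>
    integrable_continuous_comp (F := fun y => F (c, y)) (by fun_prop) hm hR
  have iG : ∀ c, Integrable (fun x => G (c, basisJet h x)) (volume.restrict Omega) := fun c =>
    integrable_continuous_comp (F := fun y => G (c, y)) (by fun_prop) hm hR
  let q : V → ℝ := fun c => ∫ x in Omega, F (c, basisJet h x)
  have hq : Continuous q := continuous_iff_seqContinuous.2 fun p p₀ hp =>
    tendsto_integral_continuous_comp cF hm hR hp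
  obtain ⟨c₀, hc₀, hmin⟩ := (isCompact_sphere (0 : V) 1).exists_isMinOn
    (NormedSpace.sphere_nonempty.2 zero_le_one) hq.continuousOn
  have hc₀n : ‖c₀‖ = 1 := mem_sphere_zero_iff_norm.1 hc₀
  have hpos : 0 < q c₀ := by
    refine lt_of_le_of_ne (integral_nonneg fun x => sq_nonneg _) fun he => ?_
    have : c₀ = 0 := interp_eq_zero_of_integral_sq hh (iF c₀) he.symm
    simp [this] at hc₀n
  have hscale : ∀ (a : ℝ) (c : V), q (a • c) = a ^ 2 * q c := by
    intro a c
    rw [← integral_const_mul]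
    refine integral_congr_ae (Eventually.of_forall fun x => ?_)
    change (∑ i, a * c i * (basisJet h x i).1) ^ 2 = a ^ 2 * (∑ i, c i * (basisJet h x i).1) ^ 2
    simp only [mul_assoc, ← Finset.mul_sum, mul_pow]
  have hlow : ∀ c : V, q c₀ * ‖c‖ ^ 2 ≤ q c := by
    intro c
    rcases eq_or_ne c 0 with rfl | hc
    · simpa using integral_nonneg fun x => sq_nonneg _
    · have hn : ‖c‖ ≠ 0 := norm_ne_zero_iff.2 hc
      have hs : ‖c‖⁻¹ • c ∈ Metric.sphere (0 : V) 1 := by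
        rw [mem_sphere_zero_iff_norm, norm_smul, norm_inv, norm_norm, inv_mul_cancel₀ hn]
      have h1 : q c₀ ≤ q (‖c‖⁻¹ • c) := hmin hs
      have h2 : q c = ‖c‖ ^ 2 * q (‖c‖⁻¹ • c) := by
        rw [hscale]; field_simp
      rw [h2, mul_comm]
      gcongr
  refine ⟨q c₀, hpos, fun u hu => (hlow _).trans ?_⟩
  have hH : H1normSq u = ∫ x in Omega, (F (fun i => u (node h i), basisJet h x)
      + G (fun i => u (node h i), basisJet h x)) := by
    refine integral_congr_ae ?_
    filter_upwards [ae_grad_eq hh, ae_restrict_mem isOpen_Omega.measurableSet] with x hx hxO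
    rw [hx u hu, hu.eq_interp hh x (Omega_subset_OmegaCl hxO)]
    rfl
  rw [hH]
  exact integral_mono (iF _) ((iF _).add (iG _)) fun x => le_add_of_nonneg_right (sq_nonneg _)

lemma TendstoF.tendsto_node {h : ℕ} (hh : 1 ≤ h) {u : ℕ → E2 → ℝ} {ub : E2 → ℝ}
    (hu : ∀ n, MemF h (u n)) (hub : MemF h ub) (hc : TendstoF u ub)
    (i : Fin (h + 1) × Fin (h + 1)) :
    Tendsto (fun n => u n (node h i)) atTop (nhds (ub (node h i))) := by
  obtain ⟨m, hm, H⟩ := exists_coercive hh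
  have hlim : Tendsto (fun n => m⁻¹ * H1normSq (fun y => u n y - ub y)) atTop (nhds 0) := by
    simpa using hc.const_mul m⁻¹
  have hsq : Tendsto (fun n => (u n (node h i) - ub (node h i)) ^ 2) atTop (nhds 0) := by
    refine squeeze_zero (fun n => sq_nonneg _) (fun n => ?_) hlim
    have h1 := H _ ((hu n).sub hub)
    have h2 := norm_le_pi_norm (fun i => u n (node h i) - ub (node h i)) i
    rw [le_inv_mul_iff₀ hm]
    refine le_trans ?_ h1
    rw [← sq_abs, ← Real.norm_eq_abs]
    gcongr
  have habs : Tendsto (fun n => |u n (node h i) - ub (node h i)|) atTop (nhds 0) := by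
    simpa [Real.sqrt_sq_eq_abs] using hsq.sqrt
  exact tendsto_sub_nhds_zero_iff.1 ((tendsto_zero_iff_abs_tendsto_zero _).2 habs)

lemma MemF.tendsto_of_tendsto_node {h : ℕ} (hh : 1 ≤ h) {u : ℕ → E2 → ℝ} {ub : E2 → ℝ}
    (hu : ∀ n, MemF h (u n)) (hub : MemF h ub)
    (hc : ∀ i, Tendsto (fun n => u n (node h i)) atTop (nhds (ub (node h i))))
    {x : E2} (hx : x ∈ OmegaCl) : Tendsto (fun n => u n x) atTop (nhds (ub x)) := by
  rw [hub.eq_interp hh x hx]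
  simp only [fun n => (hu n).eq_interp hh x hx]
  exact tendsto_finsetSum _ fun i _ => (hc i).mul_const _

/-- (Stability of the minimum problems, Lemma 1.) If `u_k ∈ 𝔄_h(w_k)`
minimizes `J_h(·, z_k)` over `𝔄_h(w_k)`, `v_k` minimizes `J_h(u_k, ·)` over
`{v ∈ 𝔽_h : v ≤ z_k on Ω}`, and `u_k → ū`, `v_k → v̄`, `w_k → w̄`, `z_k → z̄` in `𝔽_h`,
then `ū ∈ 𝔄_h(w̄)`, `ū` minimizes `J_h(·, z̄)` over `𝔄_h(w̄)`, and
`J_h(ū, v̄) ≤ J_h(ū, v)` for every `v ∈ 𝔽_h` with `v ≤ z̄` on `Ω`. -/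
theorem statement11 (h : ℕ) (hh : 1 ≤ h) (η : ℝ) (hη : 0 < η)
    (u v w z : ℕ → E2 → ℝ)
    (hwk : ∀ k, MemF h (w k)) (hzk : ∀ k, MemF h (z k)) (hvk : ∀ k, MemF h (v k))
    (huk : ∀ k, MemA h (w k) (u k))
    (hminu : ∀ k, ∀ u', MemA h (w k) u' → Jh h η (u k) (z k) ≤ Jh h η u' (z k))
    (hminv : ∀ k, ∀ v', MemF h v' → (∀ x ∈ Omega, v' x ≤ z k x) →
      Jh h η (u k) (v k) ≤ Jh h η (u k) v')
    (ub vb wb zb : E2 → ℝ)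
    (hub : MemF h ub) (hvb : MemF h vb) (hwb : MemF h wb) (hzb : MemF h zb)
    (hcu : TendstoF u ub) (hcv : TendstoF v vb)
    (hcw : TendstoF w wb) (hcz : TendstoF z zb) :
    MemA h wb ub ∧
    (∀ u', MemA h wb u' → Jh h η ub zb ≤ Jh h η u' zb) ∧
    (∀ v', MemF h v' → (∀ x ∈ Omega, v' x ≤ zb x) → Jh h η ub vb ≤ Jh h η ub v') := by
  have tu := hcu.tendsto_node hh (fun k => (huk k).1) hub
  have tv := hcv.tendsto_node hh hvk hvb
  have tw := hcw.tendsto_node hh hwk hwb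
  have tz := hcz.tendsto_node hh hzk hzb
  have shift : ∀ {f : ℕ → E2 → ℝ} {fb g : E2 → ℝ},
      (∀ i, Tendsto (fun n => f n (node h i)) atTop (nhds (fb (node h i)))) →
      ∀ i, Tendsto (fun n => g (node h i) - fb (node h i) + f n (node h i)) atTop
        (nhds (g (node h i))) := fun {f fb g} tf i => by
    simpa using (tf i).const_add (g (node h i) - fb (node h i))
  refine ⟨⟨hub, fun x hx => ?_⟩, fun u' hu' => ?_, fun v' hv' hle => ?_⟩
  · have h1 := MemF.tendsto_of_tendsto_node hh (fun k => (huk k).1) hub tu hx.1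
    have h2 := MemF.tendsto_of_tendsto_node hh hwk hwb tw hx.1
    simp only [fun n => (huk n).2 x hx] at h1
    exact tendsto_nhds_unique h1 h2
  · have hm : ∀ n, MemF h fun y => u' y - wb y + w n y := fun n => (hu'.1.sub hwb).add (hwk n)
    refine le_of_tendsto_of_tendsto' (MemF.tendsto_Jh hh η (fun k => (huk k).1) hzk hub hzb tu tz)
      (MemF.tendsto_Jh hh η hm hzk hu'.1 hzb (shift tw) tz) fun n => ?_
    exact hminu n _ ⟨hm n, fun x hx => by simp [hu'.2 x hx]⟩
  · have hm : ∀ n, MemF h fun y => v' y - zb y + z n y := fun n => (hv'.sub hzb).add (hzk n)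
    refine le_of_tendsto_of_tendsto' (MemF.tendsto_Jh hh η (fun k => (huk k).1) hvk hub hvb tu tv)
      (MemF.tendsto_Jh hh η (fun k => (huk k).1) hm hub hv' tu (shift tz)) fun n => ?_
    exact hminv n _ (hm n) fun x hx => by linarith [hle x hx]
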